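/- arXiv:2507.20580 — 4 statements merged into one kernel-verified Lean document; each statement's English description precedes it below -/
import Mathlib

section
/- Fix t₁ ∈ ℕ and a matrix D₁ ∈ ℝ^{(n+m)×t₁}. For each t₂ ∈ ℕ let D₂(t₂) ∈ ℝ^{(n+m)×t₂} be a matrix, and suppose there exists a nonzero vector a ∈ ℝ^{n+m} with aᵀ D₂(t₂) = 0 for all t₂. Define Φ(t₂) = (1/(t₁+t₂)) (D₁ D₁ᵀ + D₂(t₂) D₂(t₂)ᵀ). Then the smallest eigenvalue of the symmetric positive semidefinite matrix Φ(t₂) tends to 0 as t₂ → ∞. -/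
open Matrix Filter

/-- The smallest eigenvalue of a real symmetric matrix bounds its quadratic form from below. -/
theorem Matrix.IsHermitian.iInf_eigenvalues_mul_dotProduct_le {ι : Type*} [Fintype ι]
    [DecidableEq ι] {A : Matrix ι ι ℝ} (hA : A.IsHermitian) (x : ι → ℝ) :
    (⨅ i, hA.eigenvalues i) * (x ⬝ᵥ x) ≤ x ⬝ᵥ (A *ᵥ x) := by
  set c := ⨅ i, hA.eigenvalues i
  have hB : (A - c • (1 : Matrix ι ι ℝ)).IsHermitian :=
    hA.sub (by simp [Matrix.IsHermitian])
  have hpos : (A - c • (1 : Matrix ι ι ℝ)).PosSemidef := by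
    rw [hB.posSemidef_iff_eigenvalues_nonneg]
    intro i
    change 0 ≤ hB.eigenvalues i
    have hi := hB.eigenvalues_mem_spectrum_real i
    generalize hB.eigenvalues i = μ at hi ⊢
    rw [← Algebra.algebraMap_eq_smul_one, ← spectrum.sub_singleton_eq,
      hA.spectrum_real_eq_range_eigenvalues] at hi
    obtain ⟨_, ⟨j, rfl⟩, _, rfl, h⟩ := hi
    have hj : c ≤ hA.eigenvalues j := ciInf_le (Set.finite_range _).bddBelow j
    linarith
  have h := hpos.dotProduct_mulVec_nonneg x
  simp only [star_trivial, sub_mulVec, smul_mulVec, one_mulVec, dotProduct_sub, dotProduct_smul,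
    smul_eq_mul] at h
  linarith

theorem Matrix.dotProduct_mul_transpose_mulVec {ι κ R : Type*} [Fintype ι] [Fintype κ]
    [CommSemiring R] (A : Matrix ι κ R) (x : ι → R) :
    x ⬝ᵥ ((A * Aᵀ) *ᵥ x) = (x ᵥ* A) ⬝ᵥ (x ᵥ* A) := by
  rw [← mulVec_mulVec, mulVec_transpose, dotProduct_mulVec]

/-- If a fixed nonzero vector `a` annihilates all the appended data blocks `D₂ t₂`, then the
smallest eigenvalue of the sample covariance matrix
`Φ(t₂) = (1/(t₁+t₂)) (D₁ D₁ᵀ + D₂(t₂) D₂(t₂)ᵀ)` tends to `0` as `t₂ → ∞`. -/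
theorem stmt1 (n m t₁ : ℕ) (D₁ : Matrix (Fin (n + m)) (Fin t₁) ℝ)
    (D₂ : (t₂ : ℕ) → Matrix (Fin (n + m)) (Fin t₂) ℝ)
    (a : Fin (n + m) → ℝ) (ha : a ≠ 0)
    (haD₂ : ∀ t₂, Matrix.vecMul a (D₂ t₂) = 0)
    (Φ : ℕ → Matrix (Fin (n + m)) (Fin (n + m)) ℝ)
    (hΦ : ∀ t₂, Φ t₂ = ((1 : ℝ) / (t₁ + t₂)) • (D₁ * D₁ᵀ + D₂ t₂ * (D₂ t₂)ᵀ))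
    (hHerm : ∀ t₂, (Φ t₂).IsHermitian) :
    Tendsto (fun t₂ => ⨅ i, (hHerm t₂).eigenvalues i) atTop (nhds 0) := by
  have hpos : 0 < a ⬝ᵥ a :=
    lt_of_le_of_ne (Finset.sum_nonneg fun i _ => mul_self_nonneg (a i))
      fun h => ha (dotProduct_self_eq_zero.mp h.symm)
  have hlim : Tendsto (fun t₂ : ℕ =>
      (1 : ℝ) / (t₁ + t₂) * ((a ᵥ* D₁) ⬝ᵥ (a ᵥ* D₁)) / (a ⬝ᵥ a)) atTop (nhds 0) := by
    have h : Tendsto (fun t₂ : ℕ => (1 : ℝ) / (t₁ + t₂)) atTop (nhds 0) :=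
      (tendsto_const_nhds (x := (1 : ℝ))).div_atTop
        (tendsto_atTop_add_const_left _ _ tendsto_natCast_atTop_atTop)
    simpa using (h.mul_const ((a ᵥ* D₁) ⬝ᵥ (a ᵥ* D₁))).div_const (a ⬝ᵥ a)
  refine tendsto_of_tendsto_of_tendsto_of_le_of_le tendsto_const_nhds hlim
    (fun t₂ => Real.iInf_nonneg fun i => ?_) fun t₂ => ?_
  · have hpsd : (Φ t₂).PosSemidef := by
      rw [hΦ]
      have h := (posSemidef_self_mul_conjTranspose D₁).add
        (posSemidef_self_mul_conjTranspose (D₂ t₂))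
      simp only [conjTranspose_eq_transpose_of_trivial] at h
      exact h.smul (by positivity)
    exact hpsd.eigenvalues_nonneg i
  · have h := (hHerm t₂).iInf_eigenvalues_mul_dotProduct_le a
    have hquad : a ⬝ᵥ (Φ t₂ *ᵥ a) = (1 : ℝ) / (t₁ + t₂) * ((a ᵥ* D₁) ⬝ᵥ (a ᵥ* D₁)) := by
      rw [hΦ, smul_mulVec, dotProduct_smul, add_mulVec, dotProduct_add,
        dotProduct_mul_transpose_mulVec, dotProduct_mul_transpose_mulVec, haD₂]
      simp
    rw [hquad] at h
    exact (le_div_iff₀ hpos).mpr h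
end

section
/- Let Â ∈ ℝ^{n×n}, B̂ ∈ ℝ^{n×m}, let Q ∈ ℝ^{n×n} and R ∈ ℝ^{m×m} be symmetric, let H ∈ ℝ^{n×n} be symmetric, let β ∈ ℝ, set S = R + B̂ᵀ H B̂, assume S is invertible, define K = S⁻¹ B̂ᵀ H Â, and assume H satisfies the modified discrete algebraic Riccati equation Âᵀ H Â − β² H − Âᵀ H B̂ S⁻¹ B̂ᵀ H Â + Q = 0. Then for every v ∈ ℝ, (Â − v B̂ K)ᵀ H (Â − v B̂ K) − β² H = −Q + Kᵀ((v−1)² B̂ᵀ H B̂ + (1−2v) R) K. -/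
open Matrix

/-- Key algebraic identity in the proof of Theorem 2: if `H` solves the modified DARE
`Âᵀ H Â − β² H − Âᵀ H B̂ S⁻¹ B̂ᵀ H Â + Q = 0` with `S = R + B̂ᵀ H B̂` and
`K = S⁻¹ B̂ᵀ H Â`, then for every `v ∈ ℝ`,
`(Â − v B̂K)ᵀ H (Â − v B̂K) − β² H = −Q + Kᵀ((v−1)² B̂ᵀ H B̂ + (1−2v) R) K`. -/
theorem stmt5 (n m : ℕ)
    (Ahat : Matrix (Fin n) (Fin n) ℝ) (Bhat : Matrix (Fin n) (Fin m) ℝ)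
    (Q : Matrix (Fin n) (Fin n) ℝ) (hQ : Q.IsHermitian)
    (R : Matrix (Fin m) (Fin m) ℝ) (hR : R.IsHermitian)
    (H : Matrix (Fin n) (Fin n) ℝ) (hH : H.IsHermitian)
    (β : ℝ)
    (S : Matrix (Fin m) (Fin m) ℝ) (hS : S = R + Bhatᵀ * H * Bhat)
    (hSinv : IsUnit S)
    (K : Matrix (Fin m) (Fin n) ℝ) (hK : K = S⁻¹ * Bhatᵀ * H * Ahat)
    (hDARE : Ahatᵀ * H * Ahat - β ^ 2 • H - Ahatᵀ * H * Bhat * S⁻¹ * Bhatᵀ * H * Ahat + Q = 0) :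
    ∀ v : ℝ,
      (Ahat - v • (Bhat * K))ᵀ * H * (Ahat - v • (Bhat * K)) - β ^ 2 • H =
        -Q + Kᵀ * ((v - 1) ^ 2 • (Bhatᵀ * H * Bhat) + (1 - 2 * v) • R) * K := by
  intro v
  have hHt : Hᵀ = H := by
    simpa only [Matrix.conjTranspose_eq_transpose_of_trivial] using hH.eq
  have hRt : Rᵀ = R := by
    simpa only [Matrix.conjTranspose_eq_transpose_of_trivial] using hR.eq
  have hSt : Sᵀ = S := by
    simp [hS, Matrix.transpose_mul, hHt, hRt, Matrix.mul_assoc]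
  have hSK : Bhatᵀ * H * Ahat = S * K := by
    simp only [hK, Matrix.mul_assoc,
      Matrix.mul_nonsing_inv_cancel_left _ _ ((Matrix.isUnit_iff_isUnit_det S).mp hSinv)]
  have hKS : Ahatᵀ * H * Bhat = Kᵀ * S := by
    have h := congrArg Matrix.transpose hSK
    simpa [Matrix.transpose_mul, hHt, hSt, Matrix.mul_assoc] using h
  have hquad : Ahatᵀ * H * Bhat * S⁻¹ * Bhatᵀ * H * Ahat = Kᵀ * S * K := by
    rw [← hKS, hK]
    simp only [Matrix.mul_assoc]
  have hA : Ahatᵀ * H * Ahat - β ^ 2 • H = Kᵀ * S * K - Q := by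
    rw [hquad] at hDARE
    rw [← sub_eq_zero, ← hDARE]
    abel
  have hexpand : (Ahat - v • (Bhat * K))ᵀ * H * (Ahat - v • (Bhat * K)) =
      Ahatᵀ * H * Ahat - v • (Ahatᵀ * H * Bhat * K) - v • (Kᵀ * (Bhatᵀ * H * Ahat))
        + v ^ 2 • (Kᵀ * (Bhatᵀ * H * Bhat) * K) := by
    simp only [Matrix.transpose_sub, Matrix.transpose_smul, Matrix.transpose_mul,
      Matrix.sub_mul, Matrix.mul_sub, Matrix.smul_mul, Matrix.mul_smul, Matrix.mul_assoc]
    module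
  calc _ = (Ahatᵀ * H * Ahat - β ^ 2 • H) - v • (Ahatᵀ * H * Bhat * K)
        - v • (Kᵀ * (Bhatᵀ * H * Ahat)) + v ^ 2 • (Kᵀ * (Bhatᵀ * H * Bhat) * K) := by
        rw [hexpand]
        abel
    _ = _ := by
        rw [hA, hKS, hSK, hS]
        simp only [Matrix.add_mul, Matrix.mul_add, Matrix.smul_mul, Matrix.mul_smul,
          Matrix.mul_assoc]
        module
end

section
/- Let Â ∈ ℝ^{n×n}, B̂ ∈ ℝ^{n×m}, let Q ∈ ℝ^{n×n} and R ∈ ℝ^{m×m} be symmetric, let H ∈ ℝ^{n×n} be symmetric, let β ∈ ℝ, set S = R + B̂ᵀ H B̂, assume S is invertible, define K = S⁻¹ B̂ᵀ H Â, and assume H satisfies the modified discrete algebraic Riccati equation Âᵀ H Â − β² H − Âᵀ H B̂ S⁻¹ B̂ᵀ H Â + Q = 0. If v ∈ ℝ is such that Q − Kᵀ((v−1)² B̂ᵀ H B̂ + (1−2v) R) K is positive semidefinite, then β² H − (Â − v B̂ K)ᵀ H (Â − v B̂ K) is positive semidefinite. -/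
open Matrix

/-- If `H` solves the modified DARE and `v` is such that
`Q − Kᵀ((v−1)² B̂ᵀ H B̂ + (1−2v) R) K ⪰ 0`, then
`β² H − (Â − v B̂K)ᵀ H (Â − v B̂K) ⪰ 0`. -/
theorem stmt6 (n m : ℕ)
    (Ahat : Matrix (Fin n) (Fin n) ℝ) (Bhat : Matrix (Fin n) (Fin m) ℝ)
    (Q : Matrix (Fin n) (Fin n) ℝ) (hQ : Q.IsHermitian)
    (R : Matrix (Fin m) (Fin m) ℝ) (hR : R.IsHermitian)
    (H : Matrix (Fin n) (Fin n) ℝ) (hH : H.IsHermitian)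
    (β : ℝ)
    (S : Matrix (Fin m) (Fin m) ℝ) (hS : S = R + Bhatᵀ * H * Bhat)
    (hSinv : IsUnit S)
    (K : Matrix (Fin m) (Fin n) ℝ) (hK : K = S⁻¹ * Bhatᵀ * H * Ahat)
    (hDARE : Ahatᵀ * H * Ahat - β ^ 2 • H - Ahatᵀ * H * Bhat * S⁻¹ * Bhatᵀ * H * Ahat + Q = 0)
    (v : ℝ)
    (hv : (Q - Kᵀ * ((v - 1) ^ 2 • (Bhatᵀ * H * Bhat) + (1 - 2 * v) • R) * K).PosSemidef) :
    (β ^ 2 • H - (Ahat - v • (Bhat * K))ᵀ * H * (Ahat - v • (Bhat * K))).PosSemidef := by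
  have hHt : Hᵀ = H := hH
  have hRt : Rᵀ = R := hR
  have hSt : Sᵀ = S := by
    rw [hS]
    simp [Matrix.transpose_mul, hHt, hRt, Matrix.mul_assoc]
  have hSK : Bhatᵀ * H * Ahat = S * K := by
    rw [hK]
    simp only [← Matrix.mul_assoc]
    rw [Matrix.mul_nonsing_inv S ((Matrix.isUnit_iff_isUnit_det S).1 hSinv), Matrix.one_mul]
  have hSK' : Ahatᵀ * H * Bhat = Kᵀ * S := by
    have h := congrArg Matrix.transpose hSK
    simpa [Matrix.transpose_mul, hHt, hSt, Matrix.mul_assoc] using h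
  have hGain : Ahatᵀ * H * Bhat * S⁻¹ * Bhatᵀ * H * Ahat = Kᵀ * S * K := by
    rw [← hSK', hK]
    simp only [Matrix.mul_assoc]
  rw [hGain] at hDARE
  have hExpand : (Ahat - v • (Bhat * K))ᵀ * H * (Ahat - v • (Bhat * K)) =
      Ahatᵀ * H * Ahat - (2 * v) • (Kᵀ * S * K) + v ^ 2 • (Kᵀ * (Bhatᵀ * H * Bhat) * K) := by
    have h₁ : Kᵀ * Bhatᵀ * H * Ahat = Kᵀ * S * K := by
      rw [Matrix.mul_assoc Kᵀ S K, ← hSK]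
      simp only [Matrix.mul_assoc]
    have h₂ : Ahatᵀ * H * (Bhat * K) = Kᵀ * S * K := by
      rw [← hSK', Matrix.mul_assoc _ Bhat K]
    have h₃ : Kᵀ * Bhatᵀ * H * (Bhat * K) = Kᵀ * (Bhatᵀ * H * Bhat) * K := by
      simp only [Matrix.mul_assoc]
    simp only [Matrix.transpose_sub, Matrix.transpose_smul, Matrix.transpose_mul, Matrix.sub_mul,
      Matrix.mul_sub, Matrix.smul_mul, Matrix.mul_smul, h₁, h₂, h₃]
    module
  have hSplit : Kᵀ * S * K = Kᵀ * R * K + Kᵀ * (Bhatᵀ * H * Bhat) * K := by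
    rw [hS, Matrix.mul_add, Matrix.add_mul]
  have hβ : β ^ 2 • H = Ahatᵀ * H * Ahat - Kᵀ * S * K + Q := by
    rw [← sub_eq_zero, ← neg_eq_zero, ← hDARE]
    abel
  convert hv using 1
  rw [hExpand, hβ, hSplit]
  simp only [Matrix.mul_add, Matrix.add_mul, Matrix.smul_mul, Matrix.mul_smul]
  module
end

section
/- Let Â ∈ ℝ^{n×n}, B̂ ∈ ℝ^{n×m}, let Q ∈ ℝ^{n×n} and R ∈ ℝ^{m×m} be symmetric positive definite, let β ∈ (0,1), let H ∈ ℝ^{n×n} be symmetric positive definite satisfying the modified discrete algebraic Riccati equation Âᵀ H Â − β² H − Âᵀ H B̂ (R + B̂ᵀ H B̂)⁻¹ B̂ᵀ H Â + Q = 0 (with S = R + B̂ᵀ H B̂ invertible), and define K = S⁻¹ B̂ᵀ H Â. Let v̲ ≤ v̄ be real numbers such that for all v ∈ [v̲, v̄] the matrix Q − Kᵀ((v−1)² B̂ᵀ H B̂ + (1−2v) R) K is positive semidefinite. Let (v_k)_{k∈ℕ} be any sequence with v_k ∈ [v̲, v̄] for all k, and let (x_k)_{k∈ℕ} in ℝⁿ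 satisfy x_{k+1} = (Â − v_k B̂ K) x_k. Then ‖x_k‖ ≤ β^k · √(h_max / h_min) · ‖x_0‖ for all k ∈ ℕ, where h_min and h_max are the smallest and largest eigenvalues of H and ‖·‖ is the Euclidean norm on ℝⁿ. -/
open Matrix

/-- The quadratic form of a real symmetric matrix in coordinates of its eigenvector basis. -/
theorem Matrix.IsHermitian.dotProduct_mulVec_eq_sum_eigenvalues {n : ℕ} {H : Matrix (Fin n) (Fin n) ℝ}
    (hH : H.IsHermitian) (x : EuclideanSpace ℝ (Fin n)) :
    x.ofLp ⬝ᵥ H *ᵥ x.ofLp = ∑ i, hH.eigenvalues i * inner ℝ (hH.eigenvectorBasis i) x ^ 2 := by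
  have hexp : x.ofLp ⬝ᵥ H *ᵥ x.ofLp = inner ℝ (WithLp.toLp 2 (H *ᵥ x.ofLp)) x := by
    simp [EuclideanSpace.inner_eq_star_dotProduct]
  rw [hexp, ← hH.eigenvectorBasis.sum_inner_mul_inner]
  refine Finset.sum_congr rfl fun i _ => ?_
  have hsymm : inner ℝ (WithLp.toLp 2 (H *ᵥ x.ofLp)) (hH.eigenvectorBasis i)
      = hH.eigenvalues i * inner ℝ (hH.eigenvectorBasis i) x := by
    have hT : Hᵀ = H := by simpa [conjTranspose_eq_transpose_of_trivial] using hH.eq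
    have hv := hH.mulVec_eigenvectorBasis i
    simp only [EuclideanSpace.inner_eq_star_dotProduct, star_trivial]
    rw [dotProduct_mulVec, ← mulVec_transpose, hT, hv, smul_dotProduct, dotProduct_comm,
      smul_eq_mul]
  rw [hsymm]
  ring

/-- The quadratic form of a real symmetric matrix is at least its smallest eigenvalue. -/
theorem Matrix.IsHermitian.iInf_eigenvalues_mul_norm_sq_le {n : ℕ}
    {H : Matrix (Fin n) (Fin n) ℝ} (hH : H.IsHermitian) (x : EuclideanSpace ℝ (Fin n)) :
    (⨅ i, hH.eigenvalues i) * ‖x‖ ^ 2 ≤ x.ofLp ⬝ᵥ H *ᵥ x.ofLp := by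
  rw [hH.dotProduct_mulVec_eq_sum_eigenvalues, ← hH.eigenvectorBasis.sum_sq_norm_inner_right,
    Finset.mul_sum]
  refine Finset.sum_le_sum fun i _ => ?_
  rw [Real.norm_eq_abs, sq_abs]
  exact mul_le_mul_of_nonneg_right (ciInf_le (Set.finite_range _).bddBelow i) (sq_nonneg _)

/-- The quadratic form of a real symmetric matrix is at most its largest eigenvalue. -/
theorem Matrix.IsHermitian.le_iSup_eigenvalues_mul_norm_sq {n : ℕ}
    {H : Matrix (Fin n) (Fin n) ℝ} (hH : H.IsHermitian) (x : EuclideanSpace ℝ (Fin n)) :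
    x.ofLp ⬝ᵥ H *ᵥ x.ofLp ≤ (⨆ i, hH.eigenvalues i) * ‖x‖ ^ 2 := by
  rw [hH.dotProduct_mulVec_eq_sum_eigenvalues, ← hH.eigenvectorBasis.sum_sq_norm_inner_right,
    Finset.mul_sum]
  refine Finset.sum_le_sum fun i _ => ?_
  rw [Real.norm_eq_abs, sq_abs]
  exact mul_le_mul_of_nonneg_right (le_ciSup (Set.finite_range _).bddAbove i) (sq_nonneg _)

/-- The closed-loop Lyapunov identity under the modified DARE, with the feedback scaled by `v`. -/
theorem closedLoop_transpose_mul_mul {n m : ℕ}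
    {A : Matrix (Fin n) (Fin n) ℝ} {B : Matrix (Fin n) (Fin m) ℝ}
    {Q H : Matrix (Fin n) (Fin n) ℝ} {R S : Matrix (Fin m) (Fin m) ℝ}
    {K : Matrix (Fin m) (Fin n) ℝ} {β : ℝ}
    (hR : Rᵀ = R) (hH : Hᵀ = H) (hS : S = R + Bᵀ * H * B) (hSinv : IsUnit S)
    (hK : K = S⁻¹ * Bᵀ * H * A)
    (hDARE : Aᵀ * H * A - β ^ 2 • H - Aᵀ * H * B * S⁻¹ * Bᵀ * H * A + Q = 0) (v : ℝ) :
    (A - v • (B * K))ᵀ * H * (A - v • (B * K)) =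
      β ^ 2 • H - (Q - Kᵀ * ((v - 1) ^ 2 • (Bᵀ * H * B) + (1 - 2 * v) • R) * K) := by
  have hSK : Bᵀ * H * A = S * K := by
    rw [hK, Matrix.mul_assoc S⁻¹, Matrix.mul_assoc S⁻¹,
      mul_nonsing_inv_cancel_left _ _ ((isUnit_iff_isUnit_det S).mp hSinv)]
  have hST : Sᵀ = S := by
    rw [hS]
    simp [hR, hH, Matrix.mul_assoc]
  have hKS : Aᵀ * H * B = Kᵀ * S := by
    simpa [hH, hST, Matrix.mul_assoc] using congrArg transpose hSK
  have hKK : Aᵀ * H * B * S⁻¹ * Bᵀ * H * A = Kᵀ * S * K := by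
    rw [← hKS, hK]
    simp only [Matrix.mul_assoc]
  have hA : Aᵀ * H * A = β ^ 2 • H + Kᵀ * S * K - Q := by
    rw [hKK] at hDARE
    rw [← sub_eq_zero, ← hDARE]
    abel
  have hexp : (A - v • (B * K))ᵀ * H * (A - v • (B * K)) =
      Aᵀ * H * A - v • ((Aᵀ * H * B) * K) - v • (Kᵀ * (Bᵀ * H * A))
        + v ^ 2 • (Kᵀ * (Bᵀ * H * B) * K) := by
    simp only [transpose_sub, transpose_smul, transpose_mul, Matrix.sub_mul, Matrix.mul_sub,
      Matrix.smul_mul, Matrix.mul_smul, smul_smul, Matrix.mul_assoc, sq, smul_sub]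
    abel
  rw [hexp, hA, hSK, hKS, hS]
  simp only [Matrix.add_mul, Matrix.mul_add, Matrix.smul_mul, Matrix.mul_smul, Matrix.mul_assoc]
  module

/-- Theorem 2 (main stability theorem): under the modified DARE with `β ∈ (0,1)` and a gain
`K = S⁻¹ B̂ᵀ H Â`, if every `v ∈ [v̲, v̄]` makes
`Q − Kᵀ((v−1)² B̂ᵀ H B̂ + (1−2v) R) K ⪰ 0`, then for any sequence `v_k ∈ [v̲, v̄]`, the
closed-loop trajectory `x_{k+1} = (Â − v_k B̂K) x_k` satisfies the exponential bound
`‖x_k‖ ≤ β^k √(h_max/h_min) ‖x_0‖`. -/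
theorem stmt9 (n m : ℕ)
    (Ahat : Matrix (Fin n) (Fin n) ℝ) (Bhat : Matrix (Fin n) (Fin m) ℝ)
    (Q : Matrix (Fin n) (Fin n) ℝ) (hQ : Q.PosDef)
    (R : Matrix (Fin m) (Fin m) ℝ) (hR : R.PosDef)
    (β : ℝ) (hβ0 : 0 < β) (hβ1 : β < 1)
    (H : Matrix (Fin n) (Fin n) ℝ) (hH : H.PosDef)
    (S : Matrix (Fin m) (Fin m) ℝ) (hS : S = R + Bhatᵀ * H * Bhat)
    (hSinv : IsUnit S)
    (K : Matrix (Fin m) (Fin n) ℝ) (hK : K = S⁻¹ * Bhatᵀ * H * Ahat)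
    (hDARE : Ahatᵀ * H * Ahat - β ^ 2 • H - Ahatᵀ * H * Bhat * S⁻¹ * Bhatᵀ * H * Ahat + Q = 0)
    (vlo vhi : ℝ) (hvlohi : vlo ≤ vhi)
    (hpsd : ∀ v ∈ Set.Icc vlo vhi,
      (Q - Kᵀ * ((v - 1) ^ 2 • (Bhatᵀ * H * Bhat) + (1 - 2 * v) • R) * K).PosSemidef)
    (v : ℕ → ℝ) (hv : ∀ k, v k ∈ Set.Icc vlo vhi)
    (x : ℕ → EuclideanSpace ℝ (Fin n))
    (hx : ∀ k, (x (k + 1) : Fin n → ℝ) = (Ahat - v k • (Bhat * K)).mulVec (x k))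
    (hmin hmax : ℝ)
    (hmin_def : hmin = ⨅ i, hH.1.eigenvalues i)
    (hmax_def : hmax = ⨆ i, hH.1.eigenvalues i) :
    ∀ k : ℕ, ‖x k‖ ≤ β ^ k * Real.sqrt (hmax / hmin) * ‖x 0‖ := by
  have hHT : Hᵀ = H := by simpa [conjTranspose_eq_transpose_of_trivial] using hH.1.eq
  have hRT : Rᵀ = R := by simpa [conjTranspose_eq_transpose_of_trivial] using hR.1.eq
  have hdecay : ∀ k, x (k + 1) ⬝ᵥ H *ᵥ x (k + 1) ≤ β ^ 2 * (x k ⬝ᵥ H *ᵥ x k) := by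
    intro k
    have hid := closedLoop_transpose_mul_mul hRT hHT hS hSinv hK hDARE (v k)
    have hnonneg := (hpsd (v k) (hv k)).dotProduct_mulVec_nonneg (x k).ofLp
    have hV : x (k + 1) ⬝ᵥ H *ᵥ x (k + 1) = x k ⬝ᵥ
        ((Ahat - v k • (Bhat * K))ᵀ * H * (Ahat - v k • (Bhat * K))) *ᵥ x k := by
      rw [hx k, Matrix.mul_assoc, ← mulVec_mulVec, dotProduct_mulVec (x k).ofLp, vecMul_transpose,
        mulVec_mulVec]
    rw [star_trivial] at hnonneg
    rw [hV, hid, sub_mulVec, smul_mulVec, dotProduct_sub, dotProduct_smul, smul_eq_mul]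
    linarith
  have hpow : ∀ k, x k ⬝ᵥ H *ᵥ x k ≤ (β ^ k) ^ 2 * (x 0 ⬝ᵥ H *ᵥ x 0) := by
    intro k
    induction k with
    | zero => simp
    | succ k ih =>
      calc x (k + 1) ⬝ᵥ H *ᵥ x (k + 1) ≤ β ^ 2 * (x k ⬝ᵥ H *ᵥ x k) := hdecay k
        _ ≤ β ^ 2 * ((β ^ k) ^ 2 * (x 0 ⬝ᵥ H *ᵥ x 0)) := by gcongr
        _ = (β ^ (k + 1)) ^ 2 * (x 0 ⬝ᵥ H *ᵥ x 0) := by ring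
  intro k
  rcases isEmpty_or_nonempty (Fin n) with _ | _
  · simp [Subsingleton.elim (x k) 0, Subsingleton.elim (x 0) 0]
  have hmin_pos : 0 < hmin := by
    obtain ⟨i, hi⟩ := exists_eq_ciInf_of_finite (f := hH.1.eigenvalues)
    rw [hmin_def, ← hi]
    exact hH.eigenvalues_pos i
  have hmax_nonneg : 0 ≤ hmax :=
    hmax_def ▸ Real.iSup_nonneg fun i => (hH.eigenvalues_pos i).le
  have hlow := hH.1.iInf_eigenvalues_mul_norm_sq_le (x k)
  have hupp := hH.1.le_iSup_eigenvalues_mul_norm_sq (x 0)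
  rw [← hmin_def] at hlow
  rw [← hmax_def] at hupp
  refine (sq_le_sq₀ (norm_nonneg _) (by positivity)).mp ?_
  rw [mul_pow, mul_pow, Real.sq_sqrt (by positivity)]
  have hbound : hmin * ‖x k‖ ^ 2 ≤ (β ^ k) ^ 2 * (hmax * ‖x 0‖ ^ 2) :=
    hlow.trans ((hpow k).trans (by gcongr))
  calc ‖x k‖ ^ 2 ≤ (β ^ k) ^ 2 * (hmax * ‖x 0‖ ^ 2) / hmin := by
        rwa [le_div_iff₀' hmin_pos]
    _ = (β ^ k) ^ 2 * (hmax / hmin) * ‖x 0‖ ^ 2 := by ring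
end
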